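/- Let 𝒟 be a monotone upper semi-continuous decomposition of a Peano continuum X, let f : X → X/𝒟 be the decomposition map, and let x ∈ X be a point with {x} ∈ 𝒟. If x is a local cut point which is not a global cut point, then f(x) is a local cut point of X/𝒟 and val(x) = val(f(x)). -/

import Mathlib

open Set Pointwise

/-- A generalized Peano continuum: a connected, locally compact, locally connected,
σ-compact, metrizable topological space. -/
structure IsGenPeanoContinuum (X : Type*) [TopologicalSpace X] : Prop where
  connectedSpace : ConnectedSpace X
  locallyCompactSpace : LocallyCompactSpace X
  locallyConnectedSpace : LocallyConnectedSpace X
  sigmaCompactSpace : SigmaCompactSpace X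
  metrizableSpace : TopologicalSpace.MetrizableSpace X

/-- An exhaustion of a space by compact sets. -/
structure IsExhaustion {X : Type*} [TopologicalSpace X] (C : ℕ → Set X) : Prop where
  isCompact : ∀ i, IsCompact (C i)
  subset_interior : ∀ i, C i ⊆ interior (C (i + 1))
  iUnion_eq : (⋃ i, C i) = Set.univ

/-- The space of ends of `X` with respect to the exhaustion `C`: the inverse limit of the
sets of connected components of the complements `X ∖ C i`, the bonding maps being induced
by inclusion. -/
def EndsSpace {X : Type*} [TopologicalSpace X] (C : ℕ → Set X) : Type _ :=
  { E : ℕ → Set X //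
      (∀ i, ∃ x ∈ (C i)ᶜ, E i = connectedComponentIn (C i)ᶜ x) ∧
        ∀ i, E (i + 1) ⊆ E i }

/-- `EndsSpace C` is topologized as a subspace of the product of the discrete spaces of
components. -/
instance EndsSpace.instTopologicalSpace {X : Type*} [TopologicalSpace X] (C : ℕ → Set X) :
    TopologicalSpace (EndsSpace C) :=
  TopologicalSpace.induced (fun E => (E.1 : ℕ → Set X))
    (@Pi.topologicalSpace ℕ (fun _ => Set X) fun _ => ⊥)

/-- `G` acts on `X` by homeomorphisms. -/
def ContinuousActionOn (G X : Type*) [Group G] [TopologicalSpace X] [MulAction G X] : Prop :=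
  ∀ g : G, Continuous fun x : X => g • x

/-- The action of `G` on `X` is proper: for every compact `K`, only finitely many translates
of `K` meet `K`. -/
def ProperActionOn (G X : Type*) [Group G] [TopologicalSpace X] [MulAction G X] : Prop :=
  ∀ K : Set X, IsCompact K → {g : G | ((g • K) ∩ K).Nonempty}.Finite

/-- The action of `G` on `X` is cocompact: the translates of some compact set cover `X`. -/
def CocompactActionOn (G X : Type*) [Group G] [TopologicalSpace X] [MulAction G X] : Prop :=
  ∃ K : Set X, IsCompact K ∧ (⋃ g : G, g • K) = Set.univ

/-- A decomposition (partition) of `X` is encoded by a setoid `s`; the elements of the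
decomposition are the equivalence classes `{y | s.r x y}`.  The saturation of a set `A` is
the union of `A` with all decomposition elements meeting `A`. -/
def decompSat {X : Type*} (s : Setoid X) (A : Set X) : Set X :=
  {x : X | ∃ a ∈ A, s.r x a}

/-- The decomposition `s` of `X` is upper semi-continuous: every decomposition element is
closed and compact, and every open set `U` containing a decomposition element `D` contains
an open set `V` with `D ⊆ V ⊆ U` whose saturation lies in `U`. -/
structure IsUSCDecomposition {X : Type*} [TopologicalSpace X] (s : Setoid X) : Prop where
  isClosed : ∀ x : X, IsClosed {y | s.r x y}
  isCompact : ∀ x : X, IsCompact {y | s.r x y}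
  shrink : ∀ (x : X) (U : Set X), IsOpen U → {y | s.r x y} ⊆ U →
    ∃ V : Set X, IsOpen V ∧ {y | s.r x y} ⊆ V ∧ V ⊆ U ∧ decompSat s V ⊆ U

/-- The decomposition `s` is monotone: it is upper semi-continuous and each decomposition
element is connected. -/
def IsMonotoneUSCDecomposition {X : Type*} [TopologicalSpace X] (s : Setoid X) : Prop :=
  IsUSCDecomposition s ∧ ∀ x : X, IsConnected {y | s.r x y}

universe u

/-- `x` is a global cut point: `M ∖ {x}` is disconnected. -/
def IsGlobalCutPoint (M : Type*) [TopologicalSpace M] (x : M) : Prop :=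
  ¬ IsPreconnected ({x}ᶜ : Set M)

/-- The valence of `x` equals the cardinal `n`: `M ∖ {x}` has exactly `n` ends (with respect
to any exhaustion). -/
def valenceEq {M : Type u} [TopologicalSpace M] (x : M) (n : Cardinal.{u}) : Prop :=
  ∀ C : ℕ → Set (({x}ᶜ : Set M)), IsExhaustion C → Cardinal.mk (EndsSpace C) = n

/-- The valence of `x` is at least `n`: `M ∖ {x}` has at least `n` ends (with respect to any
exhaustion). -/
def valenceGe {M : Type u} [TopologicalSpace M] (x : M) (n : Cardinal.{u}) : Prop :=
  ∀ C : ℕ → Set (({x}ᶜ : Set M)), IsExhaustion C → n ≤ Cardinal.mk (EndsSpace C)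

/-- `x` is a local cut point: `M ∖ {x}` is disconnected, or it is connected and has more
than one end. -/
def IsLocalCutPoint (M : Type u) [TopologicalSpace M] (x : M) : Prop :=
  ¬ IsPreconnected ({x}ᶜ : Set M) ∨
    (IsPreconnected ({x}ᶜ : Set M) ∧ valenceGe x 2)

section Components

variable {Z W : Type*} [TopologicalSpace Z] [TopologicalSpace W]

lemma connectedComponentIn_eq_of_mem_of_mem {F : Set Z} {a b z : Z}
    (ha : z ∈ connectedComponentIn F a) (hb : z ∈ connectedComponentIn F b) :
    connectedComponentIn F a = connectedComponentIn F b :=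
  (connectedComponentIn_eq ha).trans (connectedComponentIn_eq hb).symm

lemma connectedComponentIn_subset_of_mem {F G : Set Z} {a b z : Z} (hFG : F ⊆ G)
    (ha : z ∈ connectedComponentIn F a) (hb : z ∈ connectedComponentIn G b) :
    connectedComponentIn F a ⊆ connectedComponentIn G b := by
  rw [connectedComponentIn_eq hb]
  exact isPreconnected_connectedComponentIn.subset_connectedComponentIn ha
    ((connectedComponentIn_subset F a).trans hFG)

lemma isConnected_restrictPreimage_fiber {Y : Type*} {g : Z → Y} {S : Set Y} {t : S}
    (h : IsConnected (g ⁻¹' {t.1})) :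
    IsConnected (S.restrictPreimage g ⁻¹' {t}) := by
  have himage : Subtype.val '' (S.restrictPreimage g ⁻¹' {t}) = g ⁻¹' {t.1} := by
    ext z
    constructor
    · rintro ⟨z, hz, rfl⟩
      exact congrArg Subtype.val hz
    · intro hz
      have hz' : g z = t.1 := hz
      exact ⟨⟨z, by simp [hz']⟩, Subtype.ext hz', rfl⟩
  rw [← himage] at h
  exact ⟨h.nonempty.of_image, Topology.IsInducing.subtypeVal.isPreconnected_image.1 h.2⟩

/-- Preimages of connected sets under a closed continuous map with connected fibres are
connected. -/
lemma IsClosedMap.isConnected_preimage {g : Z → W} (hcl : IsClosedMap g) (hg : Continuous g)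
    (hfib : ∀ w, IsConnected (g ⁻¹' {w})) {S : Set W} (hS : IsConnected S) :
    IsConnected (g ⁻¹' S) := by
  have hsurj : Function.Surjective g := fun w => (hfib w).nonempty
  have hq : Topology.IsQuotientMap (S.restrictPreimage g) :=
    (hcl.restrictPreimage S).isQuotientMap hg.restrictPreimage
      (S.restrictPreimage_surjective hsurj)
  have : ConnectedSpace S := isConnected_iff_connectedSpace.1 hS
  have h := hq.isCoinducing.isConnected_preimage_of_isClosed
    (fun t => isConnected_restrictPreimage_fiber (hfib t.1)) isClosed_univ isConnected_univ
  rw [preimage_univ] at h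
  have := h.image _ continuous_subtype_val.continuousOn
  rwa [image_univ, Subtype.range_val] at this

lemma IsClosedMap.preimage_connectedComponentIn {g : Z → W} (hcl : IsClosedMap g)
    (hg : Continuous g) (hfib : ∀ w, IsConnected (g ⁻¹' {w})) {S : Set W} {z : Z}
    (hz : g z ∈ S) :
    g ⁻¹' connectedComponentIn S (g z) = connectedComponentIn (g ⁻¹' S) z := by
  apply Subset.antisymm
  · refine IsPreconnected.subset_connectedComponentIn ?_ ?_ ?_
    · exact (hcl.isConnected_preimage hg hfib (isConnected_connectedComponentIn_iff.2 hz)).2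
    · exact mem_connectedComponentIn hz
    · exact preimage_mono (connectedComponentIn_subset S _)
  · rw [← image_subset_iff]
    refine IsPreconnected.subset_connectedComponentIn ?_ ?_ ?_
    · exact isPreconnected_connectedComponentIn.image _ hg.continuousOn
    · exact ⟨z, mem_connectedComponentIn hz, rfl⟩
    · exact image_subset_iff.2 (connectedComponentIn_subset _ _)

end Components

section Ends

variable {Z W : Type*} [TopologicalSpace Z] [TopologicalSpace W]

lemma IsExhaustion.monotone {C : ℕ → Set Z} (hC : IsExhaustion C) : Monotone C :=
  monotone_nat_of_le_succ fun i => (hC.subset_interior i).trans interior_subset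

lemma IsExhaustion.exists_subset {C : ℕ → Set Z} (hC : IsExhaustion C) {K : Set Z}
    (hK : IsCompact K) : ∃ i, K ⊆ C i :=
  CompactExhaustion.exists_superset_of_isCompact
    ⟨C, hC.isCompact, hC.subset_interior, hC.iUnion_eq⟩ hK

lemma CompactExhaustion.isExhaustion (C : CompactExhaustion Z) : IsExhaustion C :=
  ⟨C.isCompact, C.subset_interior_succ, C.iUnion_eq⟩

lemma IsExhaustion.preimage {g : Z → W} (hg : IsProperMap g) {C : ℕ → Set W}
    (hC : IsExhaustion C) : IsExhaustion fun i => g ⁻¹' C i where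
  isCompact i := hg.isCompact_preimage (hC.isCompact i)
  subset_interior i := (preimage_mono (hC.subset_interior i)).trans
    (preimage_interior_subset_interior_preimage hg.continuous)
  iUnion_eq := by rw [← preimage_iUnion, hC.iUnion_eq, preimage_univ]

/-- The image of an exhaustible space under a proper surjection is exhaustible. -/
lemma IsExhaustion.exists_of_isProperMap {g : Z → W} (hg : IsProperMap g)
    (hsurj : Function.Surjective g) {D : ℕ → Set Z} (hD : IsExhaustion D) :
    ∃ C : ℕ → Set W, IsExhaustion C := by
  have : SigmaCompactSpace W := by
    refine ⟨fun i => g '' D i, fun i => (hD.isCompact i).image hg.continuous, ?_⟩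
    rw [← image_iUnion, hD.iUnion_eq, image_univ, hsurj.range_eq]
  have : WeaklyLocallyCompactSpace W := by
    refine ⟨fun w => ?_⟩
    obtain ⟨i, hi⟩ := hD.exists_subset (hg.isCompact_preimage (isCompact_singleton (x := w)))
    refine ⟨g '' D (i + 1), (hD.isCompact _).image hg.continuous, ?_⟩
    have hmem : g ⁻¹' (g '' D (i + 1)) ∈ Filter.comap g (nhds w) := by
      refine hg.isClosedMap.comap_nhds_le ?_
      rw [mem_nhdsSet_iff_forall]
      exact fun z hz => Filter.mem_of_superset
        (isOpen_interior.mem_nhds (hD.subset_interior i (hi hz)))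
        (interior_subset.trans (subset_preimage_image _ _))
    rwa [← Filter.mem_map, Filter.map_comap_of_surjective hsurj] at hmem
  exact ⟨_, (default : CompactExhaustion W).isExhaustion⟩

/-- The ends of `Z`, described by coherent choices of components of the complements of all
compact sets. -/
def CompactEnds (Z : Type*) [TopologicalSpace Z] : Type _ :=
  { e : TopologicalSpace.Compacts Z → Set Z //
      (∀ K : TopologicalSpace.Compacts Z, ∃ z ∈ (K : Set Z)ᶜ,
        e K = connectedComponentIn (K : Set Z)ᶜ z) ∧
        ∀ K L, K ≤ L → e L ⊆ e K }

lemma EndsSpace.antitone {C : ℕ → Set Z} (E : EndsSpace C) : Antitone E.1 :=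
  antitone_nat_of_succ_le E.2.2

lemma EndsSpace.nonempty {C : ℕ → Set Z} (E : EndsSpace C) (i : ℕ) : (E.1 i).Nonempty := by
  obtain ⟨z, hz, h⟩ := E.2.1 i
  exact ⟨z, h ▸ mem_connectedComponentIn hz⟩

lemma EndsSpace.subset_compl {C : ℕ → Set Z} (E : EndsSpace C) (i : ℕ) : E.1 i ⊆ (C i)ᶜ := by
  obtain ⟨z, -, h⟩ := E.2.1 i
  exact h ▸ connectedComponentIn_subset _ _

lemma EndsSpace.isPreconnected {C : ℕ → Set Z} (E : EndsSpace C) (i : ℕ) :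
    IsPreconnected (E.1 i) := by
  obtain ⟨z, -, h⟩ := E.2.1 i
  exact h ▸ isPreconnected_connectedComponentIn

/-- An end with respect to an exhaustion extends to all compact sets. -/
lemma EndsSpace.exists_compactEnds {C : ℕ → Set Z} (hC : IsExhaustion C) (E : EndsSpace C) :
    ∃ e : CompactEnds Z, ∀ i, e.1 ⟨C i, hC.isCompact i⟩ = E.1 i := by
  choose n hn using fun K : TopologicalSpace.Compacts Z => hC.exists_subset K.isCompact
  choose p hp using fun K : TopologicalSpace.Compacts Z => E.nonempty (n K)
  have hpK : ∀ K : TopologicalSpace.Compacts Z, p K ∈ (K : Set Z)ᶜ := fun K =>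
    compl_subset_compl.2 (hn K) (E.subset_compl _ (hp K))
  have hsub : ∀ K : TopologicalSpace.Compacts Z,
      E.1 (n K) ⊆ connectedComponentIn (K : Set Z)ᶜ (p K) := fun K =>
    (E.isPreconnected _).subset_connectedComponentIn (hp K)
      ((E.subset_compl _).trans (compl_subset_compl.2 (hn K)))
  refine ⟨⟨fun K : TopologicalSpace.Compacts Z => connectedComponentIn (K : Set Z)ᶜ (p K),
    fun K => ⟨p K, hpK K, rfl⟩, ?_⟩, ?_⟩
  · intro K L hKL
    obtain ⟨z, hz⟩ := E.nonempty (max (n K) (n L))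
    exact connectedComponentIn_subset_of_mem (compl_subset_compl.2 hKL)
      (hsub L (E.antitone (le_max_right _ _) hz)) (hsub K (E.antitone (le_max_left _ _) hz))
  · intro i
    let K : TopologicalSpace.Compacts Z := ⟨C i, hC.isCompact i⟩
    obtain ⟨z, hz⟩ := E.nonempty (max (n K) i)
    obtain ⟨a, -, ha⟩ := E.2.1 i
    have hzK := hsub K (E.antitone (le_max_left _ _) hz)
    have hzi := E.antitone (le_max_right _ _) hz
    rw [ha] at hzi ⊢
    exact connectedComponentIn_eq_of_mem_of_mem hzK hzi

/-- Restricting to an exhaustion identifies `CompactEnds Z` with the space of ends. -/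
lemma IsExhaustion.nonempty_equiv_compactEnds {C : ℕ → Set Z} (hC : IsExhaustion C) :
    Nonempty (CompactEnds Z ≃ EndsSpace C) := by
  let restrict : CompactEnds Z → EndsSpace C := fun e =>
    ⟨fun i => e.1 ⟨C i, hC.isCompact i⟩, fun i => e.2.1 ⟨C i, hC.isCompact i⟩,
      fun i => e.2.2 _ _ (hC.monotone i.le_succ)⟩
  refine ⟨Equiv.ofBijective restrict ⟨fun e e' h => ?_, fun E => ?_⟩⟩
  · refine Subtype.ext (funext fun K => ?_)
    obtain ⟨i, hi⟩ := hC.exists_subset K.isCompact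
    have hi' : e.1 ⟨C i, hC.isCompact i⟩ = e'.1 ⟨C i, hC.isCompact i⟩ :=
      congrFun (congrArg Subtype.val h) i
    obtain ⟨z, hz⟩ := (restrict e).nonempty i
    have hz₁ : z ∈ e.1 K := e.2.2 K ⟨C i, hC.isCompact i⟩ hi hz
    have hz₂ : z ∈ e'.1 K := e'.2.2 K ⟨C i, hC.isCompact i⟩ hi (hi' ▸ hz)
    obtain ⟨a, -, ha⟩ := e.2.1 K
    obtain ⟨b, -, hb⟩ := e'.2.1 K
    rw [ha] at hz₁ ⊢
    rw [hb] at hz₂ ⊢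
    exact connectedComponentIn_eq_of_mem_of_mem hz₁ hz₂
  · obtain ⟨e, he⟩ := E.exists_compactEnds hC
    exact ⟨e, Subtype.ext (funext he)⟩

/-- The number of ends does not depend on the exhaustion. -/
lemma IsExhaustion.mk_endsSpace_eq {C D : ℕ → Set Z} (hC : IsExhaustion C)
    (hD : IsExhaustion D) : Cardinal.mk (EndsSpace C) = Cardinal.mk (EndsSpace D) := by
  obtain ⟨a⟩ := hC.nonempty_equiv_compactEnds
  obtain ⟨b⟩ := hD.nonempty_equiv_compactEnds
  exact Cardinal.mk_congr (a.symm.trans b)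

/-- A closed continuous map with connected fibres identifies the ends of its target with
those of its source, taken along the preimages. -/
lemma EndsSpace.nonempty_equiv_preimage {g : Z → W} (hcl : IsClosedMap g) (hg : Continuous g)
    (hfib : ∀ w, IsConnected (g ⁻¹' {w})) (C : ℕ → Set W) :
    Nonempty (EndsSpace C ≃ EndsSpace fun i => g ⁻¹' C i) := by
  have hsurj : Function.Surjective g := fun w => (hfib w).nonempty
  have hcomp {i : ℕ} {z : Z} (hz : g z ∈ (C i)ᶜ) :
      g ⁻¹' connectedComponentIn (C i)ᶜ (g z) = connectedComponentIn (g ⁻¹' C i)ᶜ z :=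
    hcl.preimage_connectedComponentIn hg hfib hz
  let pull : EndsSpace C → EndsSpace fun i => g ⁻¹' C i := fun E =>
    ⟨fun i => g ⁻¹' E.1 i, fun i => by
      obtain ⟨w, hw, h⟩ := E.2.1 i
      obtain ⟨z, rfl⟩ := hsurj w
      exact ⟨z, hw, (congrArg (preimage g) h).trans (hcomp hw)⟩, fun i => preimage_mono (E.2.2 i)⟩
  refine ⟨Equiv.ofBijective pull ⟨fun E E' h => ?_, fun E => ?_⟩⟩
  · exact Subtype.ext (funext fun i => hsurj.preimage_injective
      (congrFun (congrArg Subtype.val h) i))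
  · choose z hz hE using E.2.1
    have hpre : ∀ i, g ⁻¹' connectedComponentIn (C i)ᶜ (g (z i)) = E.1 i := fun i =>
      (hcomp (hz i)).trans (hE i).symm
    refine ⟨⟨fun i => connectedComponentIn (C i)ᶜ (g (z i)), fun i => ⟨_, hz i, rfl⟩,
      fun i => ?_⟩, Subtype.ext (funext hpre)⟩
    rw [← hsurj.preimage_subset_preimage_iff, hpre, hpre]
    exact E.2.2 i

end Ends

lemma IsUSCDecomposition.isClosedMap_mk {X : Type*} [TopologicalSpace X] {s : Setoid X}
    (hs : IsUSCDecomposition s) : IsClosedMap (Quotient.mk s) := by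
  intro F hF
  rw [← isOpen_compl_iff, ← isQuotientMap_quotient_mk'.isOpen_preimage, isOpen_iff_mem_nhds]
  intro y hy
  obtain ⟨V, hV, hyV, -, hsat⟩ := hs.shrink y Fᶜ hF.isOpen_compl fun z hyz hz =>
    hy ⟨z, hz, Quotient.sound (Setoid.symm' s hyz)⟩
  refine Filter.mem_of_superset (hV.mem_nhds (hyV (Setoid.refl' s y))) ?_
  rintro v hv ⟨z, hz, hzv⟩
  exact hsat ⟨v, hv, Quotient.exact hzv⟩ hz

lemma Quotient.mk_preimage_singleton {X : Type*} (s : Setoid X) (y : X) :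
    Quotient.mk s ⁻¹' {Quotient.mk s y} = {z | s.r y z} := by
  ext z
  exact ⟨fun h => Setoid.symm' s (Quotient.exact h), fun h => Quotient.sound (Setoid.symm' s h)⟩

lemma IsUSCDecomposition.isProperMap_mk {X : Type*} [TopologicalSpace X] {s : Setoid X}
    (hs : IsUSCDecomposition s) : IsProperMap (Quotient.mk s) := by
  refine isProperMap_iff_isClosedMap_and_compact_fibers.2
    ⟨continuous_quotient_mk', hs.isClosedMap_mk, fun q => ?_⟩
  obtain ⟨y, rfl⟩ := Quotient.exists_rep q
  exact Quotient.mk_preimage_singleton s y ▸ hs.isCompact y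

/-- The decomposition map restricts to a proper map with connected fibres between the
complements of a singleton class and of its image. -/
lemma IsMonotoneUSCDecomposition.exists_isProperMap_compl {X : Type*} [TopologicalSpace X]
    {s : Setoid X} (hs : IsMonotoneUSCDecomposition s) {x : X} (hx : {y | s.r x y} = {x}) :
    ∃ g : ({x}ᶜ : Set X) → ({Quotient.mk s x}ᶜ : Set (Quotient s)),
      IsProperMap g ∧ ∀ w, IsConnected (g ⁻¹' {w}) := by
  have hpre : ({x}ᶜ : Set X) = Quotient.mk s ⁻¹' {Quotient.mk s x}ᶜ := by
    rw [preimage_compl, Quotient.mk_preimage_singleton, hx]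
  rw [hpre]
  refine ⟨restrictPreimage _ (Quotient.mk s), hs.1.isProperMap_mk.restrictPreimage _, ?_⟩
  rintro ⟨q, hq⟩
  obtain ⟨y, rfl⟩ := Quotient.exists_rep q
  exact isConnected_restrictPreimage_fiber (Quotient.mk_preimage_singleton s y ▸ hs.2 y)

/-- Let `𝒟` be a monotone upper semi-continuous decomposition of a Peano
continuum `X` with decomposition map `f`, and let `x ∈ X` be such that `{x} ∈ 𝒟`.  If `x` is
a local cut point which is not a global cut point, then `f x` is a local cut point of `X/𝒟`
and `val(x) = val(f x)`. -/
theorem image_localCutPoint_of_monotone_usc_decomposition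
    {X : Type u} [MetricSpace X] [CompactSpace X] [ConnectedSpace X] [LocallyConnectedSpace X]
    (s : Setoid X) (hs : IsMonotoneUSCDecomposition s)
    (x : X) (hxclass : {y | s.r x y} = {x})
    (hlocal : IsLocalCutPoint X x)
    (hglobal : ¬ IsGlobalCutPoint X x) :
    IsLocalCutPoint (Quotient s) (Quotient.mk s x) ∧
      ∀ n : Cardinal.{u}, valenceEq x n ↔ valenceEq (Quotient.mk s x) n := by
  obtain ⟨g, hg, hfib⟩ := hs.exists_isProperMap_compl hxclass
  have hsurj : Function.Surjective g := fun w => (hfib w).nonempty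
  have hcard (C : ℕ → Set ({Quotient.mk s x}ᶜ : Set (Quotient s))) :
      Cardinal.mk (EndsSpace C) = Cardinal.mk (EndsSpace fun i => g ⁻¹' C i) :=
    Cardinal.mk_congr
      (EndsSpace.nonempty_equiv_preimage hg.isClosedMap hg.continuous hfib C).some
  have hconn : IsPreconnected ({x}ᶜ : Set X) := not_not.1 hglobal
  refine ⟨Or.inr ⟨?_, fun C hC => ?_⟩, fun n => ⟨fun h C hC => ?_, fun h D hD => ?_⟩⟩
  · have := isPreconnected_iff_preconnectedSpace.1 hconn
    refine isPreconnected_iff_preconnectedSpace.2 ⟨?_⟩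
    rw [← hsurj.range_eq]
    exact isPreconnected_range hg.continuous
  · rw [hcard]
    exact (hlocal.resolve_left hglobal).2 _ (hC.preimage hg)
  · rw [hcard]
    exact h _ (hC.preimage hg)
  · obtain ⟨C, hC⟩ := hD.exists_of_isProperMap hg hsurj
    rw [hD.mk_endsSpace_eq (hC.preimage hg), ← hcard]
    exact h C hC
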